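/- Fix a real number q with 0 < q < 1 and define [x]_q := (q^x − q^{−x})/(q − q^{−1}) (note [x]_{q^{−1}} = [x]_q). For a real parameter t > 0, t ≠ 1, n ∈ ℕ and N ∈ ℤ set λ_{n,N}(t) := (1+t^{−3})·[n]_t·[n+N+2]_t + [2]_t·[N]_t if N ≥ 0, and λ_{n,N}(t) := (1+t^{−3})·[n+2]_t·[n−N]_t + [2]_t·[N]_t if N ≤ 0. Then for every nonzero integer N: (i) the sets {λ_{n,N}(q) : n ∈ ℕ} and {λ_{n,−N}(q) : n ∈ ℕ} are distinct, and (ii) the sets {λ_{n,N}(q) : n ∈ ℕ} and {λ_{n,−N}(q^{−1}) : n ∈ ℕ} are distinct. -/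

import Mathlib

open Real

/-- The q-analogue `[x]_t = (t^x - t^{-x})/(t - t^{-1})` of a real number `x`. -/
noncomputable def qNum (t x : ℝ) : ℝ := (t ^ x - t ^ (-x)) / (t - t⁻¹)

/-- The eigenvalues `λ_{n,N}(t)` of the gauged Laplacian `□_N` on the charge-`N`
line bundle over `ℂP²_t`. -/
noncomputable def gaugedLaplacianEV (t : ℝ) (n : ℕ) (N : ℤ) : ℝ :=
  if 0 ≤ N then
    (1 + t ^ (-3 : ℝ)) * qNum t (n : ℝ) * qNum t ((n : ℝ) + (N : ℝ) + 2)
      + qNum t 2 * qNum t (N : ℝ)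
  else
    (1 + t ^ (-3 : ℝ)) * qNum t ((n : ℝ) + 2) * qNum t ((n : ℝ) - (N : ℝ))
      + qNum t 2 * qNum t (N : ℝ)

theorem qNum_inv {t : ℝ} (ht : 0 < t) (x : ℝ) : qNum t⁻¹ x = qNum t x := by
  unfold qNum
  rw [inv_rpow ht.le, inv_rpow ht.le, ← rpow_neg ht.le, ← rpow_neg ht.le, neg_neg, inv_inv,
    ← neg_sub (t ^ x), ← neg_sub t, neg_div_neg_eq]

theorem qNum_neg (t x : ℝ) : qNum t (-x) = -qNum t x := by
  unfold qNum
  rw [neg_neg, ← neg_sub, neg_div]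

theorem qNum_zero (t : ℝ) : qNum t 0 = 0 := by
  simp [qNum]

theorem qNum_strictMono {t : ℝ} (ht : 0 < t) (ht1 : t ≠ 1) : StrictMono (qNum t) := by
  wlog h : t < 1 generalizing t
  · have hgt : 1 < t := lt_of_le_of_ne (not_lt.mp h) ht1.symm
    have hinv := inv_lt_one_of_one_lt₀ hgt
    have := this (inv_pos.mpr ht) hinv.ne hinv
    rwa [funext (qNum_inv ht)] at this
  intro x y hxy
  have h1 : t ^ y < t ^ x := rpow_lt_rpow_of_exponent_gt ht h hxy
  have h2 : t ^ (-x) < t ^ (-y) := rpow_lt_rpow_of_exponent_gt ht h (neg_lt_neg hxy)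
  have h3 : 1 < t⁻¹ := (one_lt_inv₀ ht).mpr h
  exact div_lt_div_of_neg_of_lt (by linarith) (by linarith)

theorem qNum_nonneg {t x : ℝ} (ht : 0 < t) (ht1 : t ≠ 1) (hx : 0 ≤ x) : 0 ≤ qNum t x :=
  (qNum_zero t).symm.le.trans ((qNum_strictMono ht ht1).monotone hx)

theorem qNum_pos {t x : ℝ} (ht : 0 < t) (ht1 : t ≠ 1) (hx : 0 < x) : 0 < qNum t x :=
  (qNum_zero t).symm.le.trans_lt (qNum_strictMono ht ht1 hx)

theorem isLeast_range_gaugedLaplacianEV_of_pos {t : ℝ} (ht : 0 < t) (ht1 : t ≠ 1) {N : ℤ}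
    (hN : 0 < N) :
    IsLeast (Set.range fun n : ℕ => gaugedLaplacianEV t n N) (qNum t 2 * qNum t N) := by
  have hN' : (0 : ℝ) < N := by exact_mod_cast hN
  refine ⟨⟨0, by simp [gaugedLaplacianEV, hN.le, qNum_zero]⟩, ?_⟩
  rintro _ ⟨n, rfl⟩
  have h1 := qNum_nonneg ht ht1 (x := n) (by positivity)
  have h2 := qNum_nonneg ht ht1 (x := n + N + 2) (by positivity)
  simp only [gaugedLaplacianEV, if_pos hN.le]
  exact le_add_of_nonneg_left (by positivity)

theorem isLeast_range_gaugedLaplacianEV_neg {t : ℝ} (ht : 0 < t) (ht1 : t ≠ 1) {N : ℤ}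
    (hN : 0 < N) :
    IsLeast (Set.range fun n : ℕ => gaugedLaplacianEV t n (-N))
      (t ^ (-3 : ℝ) * (qNum t 2 * qNum t N)) := by
  have hN' : (0 : ℝ) < N := by exact_mod_cast hN
  have hneg : ¬ 0 ≤ -N := by omega
  have hev (n : ℕ) : gaugedLaplacianEV t n (-N) =
      (1 + t ^ (-3 : ℝ)) * (qNum t (n + 2) * qNum t (n + N)) - qNum t 2 * qNum t N := by
    simp only [gaugedLaplacianEV, if_neg hneg, Int.cast_neg, qNum_neg, sub_neg_eq_add]
    ring
  refine ⟨⟨0, ?_⟩, ?_⟩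
  · simp only [hev, Nat.cast_zero, zero_add]
    ring
  rintro _ ⟨n, rfl⟩
  have hn : (0 : ℝ) ≤ n := n.cast_nonneg
  have hmono := (qNum_strictMono ht ht1).monotone
  have h : qNum t 2 * qNum t N ≤ qNum t (n + 2) * qNum t (n + N) :=
    mul_le_mul (hmono (by linarith)) (hmono (by linarith)) (qNum_nonneg ht ht1 hN'.le)
      (qNum_nonneg ht ht1 (by positivity))
  have hc : 0 ≤ 1 + t ^ (-3 : ℝ) := by positivity
  simp only [hev]
  linarith [mul_le_mul_of_nonneg_left h hc]

theorem range_gaugedLaplacianEV_ne_neg {s t : ℝ} (hs : 0 < s) (hs1 : s ≠ 1) (ht : 0 < t)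
    (ht1 : t ≠ 1) (hst : qNum s = qNum t) {N : ℤ} (hN : 0 < N) :
    (Set.range fun n : ℕ => gaugedLaplacianEV s n N) ≠
      Set.range fun n : ℕ => gaugedLaplacianEV t n (-N) := by
  intro h
  have hleast := isLeast_range_gaugedLaplacianEV_of_pos hs hs1 hN
  rw [h, hst] at hleast
  have heq := hleast.unique (isLeast_range_gaugedLaplacianEV_neg ht ht1 hN)
  have hpos : 0 < qNum t 2 * qNum t N :=
    mul_pos (qNum_pos ht ht1 two_pos) (qNum_pos ht ht1 (by exact_mod_cast hN))
  have hone : t ^ (-3 : ℝ) = 1 := (right_eq_mul₀ hpos.ne').mp heq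
  rw [← one_rpow (-3), rpow_left_inj ht.le zero_le_one (by norm_num)] at hone
  exact ht1 hone

/-- For `0 < q < 1` and `N ≠ 0`, the spectrum `{λ_{n,N}(q)}` of the gauged Laplacian is
not invariant under `N ↔ -N`, not even when simultaneously sending `q ↔ q⁻¹`. -/
theorem gaugedLaplacian_spectrum_not_symmetric
    (q : ℝ) (hq0 : 0 < q) (hq1 : q < 1) (N : ℤ) (hN : N ≠ 0) :
    (Set.range (fun n : ℕ => gaugedLaplacianEV q n N) ≠
      Set.range (fun n : ℕ => gaugedLaplacianEV q n (-N))) ∧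
    (Set.range (fun n : ℕ => gaugedLaplacianEV q n N) ≠
      Set.range (fun n : ℕ => gaugedLaplacianEV q⁻¹ n (-N))) := by
  have hi0 : 0 < q⁻¹ := inv_pos.mpr hq0
  have hi1 : q⁻¹ ≠ 1 := inv_ne_one.mpr hq1.ne
  have hinv : qNum q⁻¹ = qNum q := funext (qNum_inv hq0)
  rcases hN.lt_or_gt with hneg | hpos
  · have hpos : 0 < -N := neg_pos.mpr hneg
    have h1 := range_gaugedLaplacianEV_ne_neg hq0 hq1.ne hq0 hq1.ne rfl hpos
    have h2 := range_gaugedLaplacianEV_ne_neg hi0 hi1 hq0 hq1.ne hinv hpos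
    rw [neg_neg] at h1 h2
    exact ⟨h1.symm, h2.symm⟩
  · exact ⟨range_gaugedLaplacianEV_ne_neg hq0 hq1.ne hq0 hq1.ne rfl hpos,
      range_gaugedLaplacianEV_ne_neg hq0 hq1.ne hi0 hi1 hinv.symm hpos⟩
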